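/- arXiv:1710.02548 — 2 statements merged into one kernel-verified Lean document; each statement's English description precedes it below -/
import Mathlib

section
/- Under the SFA stationary measure π̃, the expected total number of customers at resource l equals g_l/(1 − g_l): for every l ∈ L, the family m ↦ m_l · π̃(m) over m : K → ℕ is summable with Σ_{m : K → ℕ} m_l · π̃(m) = g_l/(1 − g_l), where m_l = Σ_{j : (l,j) ∈ K} m(l,j). -/
open scoped BigOperators

noncomputable section

/-- The set of resource-route pairs `(l,j)` actually used, i.e. with `B l j > 0`. -/
abbrev sfaK {L J : Type*} (B : L → J → ℝ) := {p : L × J // 0 < B p.1 p.2}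

/-- The weight function of the SFA stationary measure:
`w(m) = ∏_l [ m_l! / ∏_j m_{lj}! ] · ∏_{(l,j) ∈ K} (B_{lj} α_j / C_l)^{m_{lj}}`. -/
noncomputable def sfaW {L J : Type*} [Fintype L] [Fintype J]
    (B : L → J → ℝ) (C : L → ℝ) (α : J → ℝ) (m : sfaK B → ℕ) : ℝ :=
  (∏ l : L,
      ((Nat.factorial (∑ j : {j : J // 0 < B l j}, m ⟨(l, j.1), j.2⟩) : ℝ) /
        ∏ j : {j : J // 0 < B l j}, (Nat.factorial (m ⟨(l, j.1), j.2⟩) : ℝ))) *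
    ∏ p : sfaK B, (B p.1.1 p.1.2 * α p.1.2 / C p.1.1) ^ m p

/-- The normalizing constant `Φ = ∏_l C_l / (C_l - Σ_j B_{lj} α_j)`. -/
noncomputable def sfaPhi {L J : Type*} [Fintype L] [Fintype J]
    (B : L → J → ℝ) (C : L → ℝ) (α : J → ℝ) : ℝ :=
  ∏ l : L, C l / (C l - ∑ j : J, B l j * α j)

theorem sfa_hasSum_multinomial {ι : Type*} [Fintype ι] (x : ι → ℝ) (hx : ∀ i, 0 ≤ x i)
    (f : ℕ → ℝ) (hf : ∀ n, 0 ≤ f n) (S : ℝ)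
    (h : HasSum (fun n => f n * (∑ i, x i) ^ n) S) :
    HasSum (fun k : ι → ℕ => f (∑ i, k i) *
      (((Nat.factorial (∑ i, k i) : ℝ) / ∏ i, (Nat.factorial (k i) : ℝ)) * ∏ i, x i ^ k i)) S := by
  classical
  set F : (ι → ℕ) → ℝ := fun k => f (∑ i, k i) *
      (((Nat.factorial (∑ i, k i) : ℝ) / ∏ i, (Nat.factorial (k i) : ℝ)) * ∏ i, x i ^ k i) with hF
  have hF0 : ∀ k, 0 ≤ F k := by
    intro k
    refine mul_nonneg (hf _) (mul_nonneg (by positivity) ?_)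
    exact Finset.prod_nonneg fun i _ => pow_nonneg (hx i) _
  let e := Equiv.sigmaFiberEquiv (fun k : ι → ℕ => ∑ i, k i)
  rw [← e.hasSum_iff]
  have hfib : ∀ n, HasSum (fun y : {k : ι → ℕ // ∑ i, k i = n} => (F ∘ e) ⟨n, y⟩)
      (f n * (∑ i, x i) ^ n) := by
    intro n
    have h1 : HasSum (fun y : {k : ι → ℕ // k ∈ Finset.piAntidiag Finset.univ n} => F y.1)
        (∑ k ∈ Finset.piAntidiag Finset.univ n, F k) := Finset.hasSum _ F
    have h2 : ∑ k ∈ Finset.piAntidiag Finset.univ n, F k = f n * (∑ i, x i) ^ n := by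
      rw [Finset.sum_pow_eq_sum_piAntidiag, Finset.mul_sum]
      refine Finset.sum_congr rfl fun k hk => ?_
      have hk' : ∑ i, k i = n := by simpa using hk
      have h3 := Nat.multinomial_spec Finset.univ k
      have h4 : (Nat.factorial (∑ i, k i) : ℝ) / ∏ i, (Nat.factorial (k i) : ℝ)
          = (Nat.multinomial Finset.univ k : ℝ) := by
        rw [← h3]
        push_cast
        rw [mul_div_cancel_left₀]
        exact Finset.prod_ne_zero_iff.2 fun i _ => by positivity
      simp only [hF]
      rw [h4, hk']
    rw [h2] at h1
    let e2 : {k : ι → ℕ // ∑ i, k i = n} ≃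
        {k : ι → ℕ // k ∈ Finset.piAntidiag Finset.univ n} :=
      Equiv.subtypeEquivRight (by intro k; simp)
    exact (e2.hasSum_iff).2 h1
  have hsum : Summable (F ∘ e) := by
    refine (summable_sigma_of_nonneg (f := F ∘ e) (fun _ => hF0 _)).2 ⟨fun n => (hfib n).summable, ?_⟩
    refine h.summable.congr fun n => ?_
    exact (hfib n).tsum_eq.symm
  exact h.sigma_of_hasSum hfib hsum

/-- The product rule for nonnegative sums over a finite index type. -/
def sfaPiProp.{u, v} (L : Type u) (_ : Fintype L) : Prop := ∀ (β : L → Type v)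
    (F : ∀ l, β l → ℝ) (s : L → ℝ), (∀ l b, 0 ≤ F l b) → (∀ l, HasSum (F l) (s l)) →
    HasSum (fun m : ∀ l, β l => ∏ l, F l (m l)) (∏ l, s l)

theorem sfa_hasSum_pi_aux.{u, v} (L : Type u) [hL : Fintype L] : sfaPiProp.{u, v} L hL := by
  refine @Fintype.induction_empty_option sfaPiProp.{u, v} ?_ ?_ ?_ L hL
  · intro A B _ e ih
    intro β F s hF h
    letI : Fintype A := Fintype.ofEquiv B e.symm
    have := ih (fun a => β (e a)) (fun a => F (e a)) (fun a => s (e a)) (fun a => hF _)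
      (fun a => h _)
    rw [← (Equiv.piCongrLeft β e).hasSum_iff]
    have e1 : ∏ l, s l = ∏ a, s (e a) := (Equiv.prod_comp e s).symm
    have e2 : (fun m : ∀ l, β l => ∏ l, F l (m l)) ∘ (Equiv.piCongrLeft β e) =
        fun m : ∀ a, β (e a) => ∏ a, F (e a) (m a) := by
      funext m
      simp only [Function.comp]
      rw [← Equiv.prod_comp e]
      refine Finset.prod_congr rfl fun a _ => ?_
      rw [Equiv.piCongrLeft_apply_apply]
    rw [e1, e2]
    exact this
  · intro β F s hF h
    have h1 := hasSum_unique (fun m : ∀ l : PEmpty, β l => ∏ l, F l (m l))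
    have e1 : ∏ l, s l = ∏ l, F l ((default : ∀ l : PEmpty, β l) l) :=
      Finset.prod_congr rfl fun l _ => l.elim
    rw [e1]
    exact h1
  · intro A _ ih
    intro β F s hF h
    have h1 := ih (fun a => β (some a)) (fun a => F (some a)) (fun a => s (some a))
      (fun a => hF _) (fun a => h _)
    rw [← Equiv.piOptionEquivProd.symm.hasSum_iff]
    have h2 := (h none).mul h1 ((h none).summable.mul_of_nonneg h1.summable (fun b => hF _ _)
      (fun m => Finset.prod_nonneg fun a _ => hF _ _))
    rw [Fintype.prod_option]
    have e2 : (fun m : ∀ l, β l => ∏ l, F l (m l)) ∘ (Equiv.piOptionEquivProd (β := β)).symm =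
        fun x => F none x.1 * ∏ a, F (some a) (x.2 a) := by
      funext m
      simp only [Function.comp, Fintype.prod_option]
      rfl
    rw [e2]
    exact h2

theorem sfa_hasSum_pi {L : Type*} [Fintype L] {β : L → Type*}
    (F : ∀ l, β l → ℝ) (s : L → ℝ) (hF : ∀ l b, 0 ≤ F l b) (h : ∀ l, HasSum (F l) (s l)) :
    HasSum (fun m : ∀ l, β l => ∏ l, F l (m l)) (∏ l, s l) :=
  sfa_hasSum_pi_aux L β F s hF h

/-- Currying equivalence on configurations. -/
def sfaEquiv {L J : Type*} (B : L → J → ℝ) :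
    (sfaK B → ℕ) ≃ (∀ l, {j : J // 0 < B l j} → ℕ) where
  toFun m l j := m ⟨(l, j.1), j.2⟩
  invFun k p := k p.1.1 ⟨p.1.2, p.2⟩
  left_inv _ := rfl
  right_inv _ := rfl

/-- Index equivalence. -/
def sfaSigma {L J : Type*} (B : L → J → ℝ) :
    (Σ l, {j : J // 0 < B l j}) ≃ sfaK B where
  toFun q := ⟨(q.1, q.2.1), q.2.2⟩
  invFun p := ⟨p.1.1, ⟨p.1.2, p.2⟩⟩
  left_inv _ := rfl
  right_inv _ := rfl

/-- under the SFA stationary measure `π̃(m) = w(m)/Φ`, the expected total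
number of customers at resource `l` equals `g_l / (1 - g_l)`. -/
theorem sfa_expected_total_at_resource
    {L J : Type*} [Fintype L] [Fintype J] [Nonempty L] [Nonempty J]
    (B : L → J → ℝ) (C : L → ℝ) (α : J → ℝ)
    (hB : ∀ l j, 0 ≤ B l j) (hC : ∀ l, 0 < C l) (hα : ∀ j, 0 ≤ α j)
    (hg : ∀ l, (∑ j : J, B l j * α j) / C l < 1)
    (l : L) :
    Summable (fun m : sfaK B → ℕ =>
        ((∑ j : {j : J // 0 < B l j}, m ⟨(l, j.1), j.2⟩ : ℕ) : ℝ) *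
          (sfaW B C α m / sfaPhi B C α)) ∧
      (∑' m : sfaK B → ℕ,
          ((∑ j : {j : J // 0 < B l j}, m ⟨(l, j.1), j.2⟩ : ℕ) : ℝ) *
            (sfaW B C α m / sfaPhi B C α)) =
        ((∑ j : J, B l j * α j) / C l) / (1 - (∑ j : J, B l j * α j) / C l) := by
  
  classical
  set g : L → ℝ := fun l => (∑ j : J, B l j * α j) / C l with hgdef
  have hg0 : ∀ l, 0 ≤ g l := fun l =>
    div_nonneg (Finset.sum_nonneg fun j _ => mul_nonneg (hB _ _) (hα _)) (hC l).le
  have hx0 : ∀ l (j : {j : J // 0 < B l j}), 0 ≤ B l j * α j / C l := fun l j =>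
    div_nonneg (mul_nonneg (hB _ _) (hα _)) (hC l).le
  have hxs : ∀ l, ∑ j : {j : J // 0 < B l j}, B l j * α j / C l = g l := by
    intro l
    simp only [hgdef]
    rw [← Finset.sum_div]
    congr 1
    rw [← Finset.sum_subtype (Finset.univ.filter (fun j => 0 < B l j)) (by simp) (fun j => B l j * α j)]
    · rw [Finset.sum_filter_of_ne]
      intro j _ hj
      refine lt_of_le_of_ne (hB l j) fun h0 => hj ?_
      rw [← h0, zero_mul]
  have hphi : ∀ l, C l / (C l - ∑ j : J, B l j * α j) = (1 - g l)⁻¹ := by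
    intro l
    have h1 := (hC l).ne'
    have h2 : (1 - g l) = (C l - ∑ j : J, B l j * α j) / C l := by
      simp only [hgdef]; field_simp
    rw [h2, inv_div]
  let c : L → ℕ → ℝ := fun l' n => if l' = l then (n : ℝ) else 1
  let s : L → ℝ := fun l' => (if l' = l then g l' / (1 - g l') else 1) * (1 - g l')⁻¹
  have hs : ∀ l', HasSum (fun n => c l' n * (g l') ^ n) (s l') := by
    intro l'
    have hlt : g l' < 1 := hg l'
    by_cases h : l' = l
    · simp only [c, s, if_pos h]
      have := hasSum_coe_mul_geometric_of_norm_lt_one (r := g l')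
        (by rw [Real.norm_of_nonneg (hg0 l')]; exact hlt)
      convert! this using 1
      rw [← div_eq_mul_inv, div_div, sq]
    · simp only [c, s, if_neg h, one_mul]
      exact hasSum_geometric_of_lt_one (hg0 l') hlt
  have key := sfa_hasSum_pi (β := fun l' => {j : J // 0 < B l' j} → ℕ) _ s
    (fun l' k => mul_nonneg (by simp only [c]; split_ifs <;> positivity)
      (mul_nonneg (by positivity) (Finset.prod_nonneg fun j _ => pow_nonneg (hx0 l' j) _)))
    (fun l' => sfa_hasSum_multinomial (fun j : {j : J // 0 < B l' j} => B l' j * α j / C l')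
      (hx0 l') (c l') (fun n => by simp only [c]; split_ifs <;> positivity) (s l')
      (by rw [hxs]; exact hs l'))
  rw [← (sfaEquiv B).hasSum_iff] at key
  have hpos : 0 < sfaPhi B C α := by
    unfold sfaPhi
    refine Finset.prod_pos fun l' _ => ?_
    rw [hphi]
    have := hg l'
    exact inv_pos.2 (sub_pos.2 this)
  have hprod : ∏ l', s l' = g l / (1 - g l) * sfaPhi B C α := by
    simp only [s, sfaPhi, hphi, Finset.prod_mul_distrib]
    simp
  have main : HasSum (fun m : sfaK B → ℕ =>
        ((∑ j : {j : J // 0 < B l j}, m ⟨(l, j.1), j.2⟩ : ℕ) : ℝ) *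
          (sfaW B C α m / sfaPhi B C α)) (g l / (1 - g l)) := by
    have k2 := key.div_const (sfaPhi B C α)
    rw [hprod, mul_div_cancel_right₀ _ hpos.ne'] at k2
    convert! k2 using 1
    funext m
    rw [← mul_div_assoc]
    congr 1
    simp only [Function.comp, Finset.prod_mul_distrib, sfaW]
    have e1 : ∏ l', c l' (∑ j, sfaEquiv B m l' j)
        = ((∑ j : {j : J // 0 < B l j}, m ⟨(l, j.1), j.2⟩ : ℕ) : ℝ) := by
      simp only [c, Finset.prod_ite_eq', Finset.mem_univ, if_true]
      rfl
    have e2 : ∏ p : sfaK B, (B p.1.1 p.1.2 * α p.1.2 / C p.1.1) ^ m p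
        = ∏ l', ∏ j : {j : J // 0 < B l' j}, (B l' j * α j / C l') ^ (sfaEquiv B m l' j) := by
      rw [← Equiv.prod_comp (sfaSigma B), Fintype.prod_sigma]
      rfl
    rw [e1, e2]
    rfl
  exact ⟨main.summable, main.tsum_eq⟩
end
end

section
/- Feasibility of the SFA rate allocation: for every n : J → ℕ and every resource l ∈ L, Σ_{j ∈ J, n_j ≥ 1} B_{lj} · Φ(n − e_j) ≤ C_l · Φ(n), where e_j is the j-th unit vector in ℕ^J. Equivalently, the SFA rates φ_j(n) = Φ(n − e_j)/Φ(n) satisfy the capacity constraints Σ_{j} B_{lj} φ_j(n) ≤ C_l for all l. -/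
open scoped BigOperators

noncomputable section

/-- The set `U(n)` of multi-configurations `m : K → ℕ` compatible with the route-level
counts `n : J → ℕ`, i.e. `Σ_{l : (l,j) ∈ K} m(l,j) = n_j` for all `j`. -/
abbrev sfaU {L J : Type*} [Fintype L] (B : L → J → ℝ) (n : J → ℕ) :=
  {m : sfaK B → ℕ // ∀ j : J, (∑ l : {l : L // 0 < B l j}, m ⟨(l.1, j), l.2⟩) = n j}

/-- `Φ(n) = Σ_{m ∈ U(n)} ∏_l [ m_l!/∏_j m_{lj}! ] · ∏_{(l,j) ∈ K} (B_{lj}/C_l)^{m_{lj}}`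
(the set `U(n)` is finite, so the `tsum` is just the finite sum). -/
noncomputable def sfaPhiFun {L J : Type*} [Fintype L] [Fintype J]
    (B : L → J → ℝ) (C : L → ℝ) (n : J → ℕ) : ℝ :=
  ∑' m : sfaU B n,
    (∏ l : L,
        ((Nat.factorial (∑ j : {j : J // 0 < B l j}, m.1 ⟨(l, j.1), j.2⟩) : ℝ) /
          ∏ j : {j : J // 0 < B l j}, (Nat.factorial (m.1 ⟨(l, j.1), j.2⟩) : ℝ))) *
      ∏ p : sfaK B, (B p.1.1 p.1.2 / C p.1.1) ^ m.1 p

/-- The summand of `sfaPhiFun`. -/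
noncomputable def auxW {L J : Type*} [Fintype L] [Fintype J]
    (B : L → J → ℝ) (C : L → ℝ) (m : sfaK B → ℕ) : ℝ :=
  (∏ l : L,
        ((Nat.factorial (∑ j : {j : J // 0 < B l j}, m ⟨(l, j.1), j.2⟩) : ℝ) /
          ∏ j : {j : J // 0 < B l j}, (Nat.factorial (m ⟨(l, j.1), j.2⟩) : ℝ))) *
      ∏ p : sfaK B, (B p.1.1 p.1.2 / C p.1.1) ^ m p

lemma aux_prod {ι : Type*} [Fintype ι] (f g : ι → ℝ) (a : ι) (c d : ℝ)
    (h : ∀ i, i ≠ a → f i = g i) (ha : f a * c = g a * d) :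
    (∏ i, f i) * c = (∏ i, g i) * d := by
  classical
  rw [← Finset.mul_prod_erase Finset.univ f (Finset.mem_univ a),
    ← Finset.mul_prod_erase Finset.univ g (Finset.mem_univ a)]
  have : ∏ i ∈ Finset.univ.erase a, f i = ∏ i ∈ Finset.univ.erase a, g i :=
    Finset.prod_congr rfl (fun i hi => h i (Finset.ne_of_mem_erase hi))
  rw [this]
  linear_combination (∏ i ∈ Finset.univ.erase a, g i) * ha

lemma aux_sum {ι : Type*} [Fintype ι] (f g : ι → ℕ) (a : ι)
    (h : ∀ i, i ≠ a → f i = g i) (ha : f a = g a + 1) :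
    (∑ i, f i) = (∑ i, g i) + 1 := by
  classical
  rw [← Finset.add_sum_erase Finset.univ f (Finset.mem_univ a),
    ← Finset.add_sum_erase Finset.univ g (Finset.mem_univ a)]
  have : ∑ i ∈ Finset.univ.erase a, f i = ∑ i ∈ Finset.univ.erase a, g i :=
    Finset.sum_congr rfl (fun i hi => h i (Finset.ne_of_mem_erase hi))
  rw [this]
  omega

lemma auxW_nonneg {L J : Type*} [Fintype L] [Fintype J]
    (B : L → J → ℝ) (C : L → ℝ) (hC : ∀ l, 0 < C l) (m : sfaK B → ℕ) : 0 ≤ auxW B C m := by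
  unfold auxW
  refine mul_nonneg (Finset.prod_nonneg fun l _ => by positivity)
    (Finset.prod_nonneg fun p _ => pow_nonneg (div_nonneg p.2.le (hC _).le) _)

lemma auxW_step {L J : Type*} [Fintype L] [Fintype J]
    (B : L → J → ℝ) (C : L → ℝ) (hC : ∀ l, 0 < C l) (m m' : sfaK B → ℕ)
    (l : L) (j : J) (hlj : 0 < B l j)
    (hp : m ⟨(l, j), hlj⟩ = m' ⟨(l, j), hlj⟩ + 1)
    (hq : ∀ q : sfaK B, q ≠ ⟨(l, j), hlj⟩ → m q = m' q) :
    C l * (auxW B C m * ((m ⟨(l, j), hlj⟩ : ℝ) /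
      ((∑ j : {j : J // 0 < B l j}, m ⟨(l, j.1), j.2⟩ : ℕ) : ℝ))) = B l j * auxW B C m' := by
  have hsum : (∑ j : {j : J // 0 < B l j}, m ⟨(l, j.1), j.2⟩)
      = (∑ j : {j : J // 0 < B l j}, m' ⟨(l, j.1), j.2⟩) + 1 := by
    refine aux_sum _ _ ⟨j, hlj⟩ (fun i hi => hq _ ?_) hp
    intro h
    apply hi
    simpa [Subtype.ext_iff] using h
  have h1 : (∏ p : sfaK B, (B p.1.1 p.1.2 / C p.1.1) ^ m p) * C l
      = (∏ p : sfaK B, (B p.1.1 p.1.2 / C p.1.1) ^ m' p) * B l j := by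
    refine aux_prod _ _ ⟨(l, j), hlj⟩ _ _ (fun i hi => by rw [hq i hi]) ?_
    have := (hC l).ne'
    simp only [hp, pow_succ]
    field_simp
  have h2 : (∏ j : {j : J // 0 < B l j}, (Nat.factorial (m ⟨(l, j.1), j.2⟩) : ℝ)) * 1
      = (∏ j : {j : J // 0 < B l j}, (Nat.factorial (m' ⟨(l, j.1), j.2⟩) : ℝ))
        * (m ⟨(l, j), hlj⟩ : ℝ) := by
    refine aux_prod _ _ ⟨j, hlj⟩ _ _ (fun i hi => ?_) ?_
    · rw [hq]
      intro h
      apply hi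
      simpa [Subtype.ext_iff] using h
    · simp only [hp, Nat.factorial_succ]
      push_cast
      ring
  have h3 : (∏ l : L,
        ((Nat.factorial (∑ j : {j : J // 0 < B l j}, m ⟨(l, j.1), j.2⟩) : ℝ) /
          ∏ j : {j : J // 0 < B l j}, (Nat.factorial (m ⟨(l, j.1), j.2⟩) : ℝ)))
        * ((m ⟨(l, j), hlj⟩ : ℝ) /
      ((∑ j : {j : J // 0 < B l j}, m ⟨(l, j.1), j.2⟩ : ℕ) : ℝ))
      = (∏ l : L,
        ((Nat.factorial (∑ j : {j : J // 0 < B l j}, m' ⟨(l, j.1), j.2⟩) : ℝ) /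
          ∏ j : {j : J // 0 < B l j}, (Nat.factorial (m' ⟨(l, j.1), j.2⟩) : ℝ))) * 1 := by
    refine aux_prod _ _ l _ _ (fun i hi => ?_) ?_
    · have : ∀ k : {k : J // 0 < B i k}, m ⟨(i, k.1), k.2⟩ = m' ⟨(i, k.1), k.2⟩ := by
        intro k
        apply hq
        intro h
        apply hi
        simp only [Subtype.mk.injEq, Prod.mk.injEq] at h
        exact h.1
      simp only [this]
    · rw [mul_one] at h2
      simp only [h2, hsum, Nat.factorial_succ]
      have a1 : (m ⟨(l, j), hlj⟩ : ℝ) ≠ 0 := by rw [hp]; positivity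
      have a2 : (∏ j : {j : J // 0 < B l j}, (Nat.factorial (m' ⟨(l, j.1), j.2⟩) : ℝ)) ≠ 0 := by
        positivity
      generalize (∏ j : {j : J // 0 < B l j}, (Nat.factorial (m' ⟨(l, j.1), j.2⟩) : ℝ)) = P at *
      generalize (∑ j : {j : J // 0 < B l j}, m' ⟨(l, j.1), j.2⟩) = S at *
      push_cast
      have a3 : (S : ℝ) + 1 ≠ 0 := by positivity
      field_simp
  unfold auxW
  rw [mul_one] at h3
  rw [← h3]
  linear_combination (∏ l : L,
        ((Nat.factorial (∑ j : {j : J // 0 < B l j}, m ⟨(l, j.1), j.2⟩) : ℝ) /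
          ∏ j : {j : J // 0 < B l j}, (Nat.factorial (m ⟨(l, j.1), j.2⟩) : ℝ)))
        * ((m ⟨(l, j), hlj⟩ : ℝ) /
      ((∑ j : {j : J // 0 < B l j}, m ⟨(l, j.1), j.2⟩ : ℕ) : ℝ)) * h1

lemma auxU_finite {L J : Type*} [Fintype L] [Fintype J] (B : L → J → ℝ) (n : J → ℕ) :
    Finite (sfaU B n) := by
  classical
  refine Set.Finite.subset (Set.finite_Iic (fun p : sfaK B => n p.1.2)) ?_
  intro m hm p
  obtain ⟨⟨l, j⟩, h⟩ := p
  have := hm j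
  show m ⟨(l, j), h⟩ ≤ n j
  rw [← this]
  exact Finset.single_le_sum (f := fun l : {l : L // 0 < B l j} => m ⟨(l.1, j), l.2⟩)
    (fun _ _ => Nat.zero_le _) (Finset.mem_univ (⟨l, h⟩ : {l : L // 0 < B l j}))

/-- One route's contribution. -/
lemma aux_route {L J : Type*} [Fintype L] [Fintype J]
    (B : L → J → ℝ) (C : L → ℝ) (hC : ∀ l, 0 < C l) (n n' : J → ℕ)
    (l : L) (j : J) (hlj : 0 < B l j) (hj : n j = n' j + 1) (hi : ∀ i, i ≠ j → n i = n' i) :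
    B l j * sfaPhiFun B C n' ≤ C l * ∑' m : sfaU B n, auxW B C m.1 *
      ((m.1 ⟨(l, j), hlj⟩ : ℝ) /
        ((∑ j : {j : J // 0 < B l j}, m.1 ⟨(l, j.1), j.2⟩ : ℕ) : ℝ)) := by
  classical
  have := auxU_finite B n
  have := auxU_finite B n'
  have hU : ∀ m : sfaU B n', ∀ i : J, (∑ k : {k : L // 0 < B k i},
      (fun q => if q = (⟨(l, j), hlj⟩ : sfaK B) then m.1 q + 1 else m.1 q) ⟨(k.1, i), k.2⟩)
        = n i := by
    intro m i
    by_cases h : i = j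
    · subst h
      rw [hj, ← m.2 i]
      refine aux_sum _ _ ⟨l, hlj⟩ (fun k hk => ?_) (by simp)
      refine if_neg ?_
      intro h
      apply hk
      simpa [Subtype.ext_iff] using h
    · rw [hi i h, ← m.2 i]
      refine Finset.sum_congr rfl fun k _ => if_neg ?_
      intro h'
      apply h
      simp only [Subtype.mk.injEq, Prod.mk.injEq] at h'
      exact h'.2
  let φ : sfaU B n' → sfaU B n := fun m => ⟨fun q => if q = (⟨(l, j), hlj⟩ : sfaK B) then m.1 q + 1 else m.1 q, hU m⟩
  have hφ : Function.Injective φ := by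
    intro a b hab
    apply Subtype.ext
    funext q
    have := congrFun (congrArg Subtype.val hab) q
    simp only [φ] at this
    split_ifs at this <;> omega
  unfold sfaPhiFun
  rw [← tsum_mul_left, ← tsum_mul_left]
  refine Summable.tsum_le_tsum_of_inj φ hφ (fun m _ => ?_) (fun m => ?_)
    Summable.of_finite Summable.of_finite
  · exact mul_nonneg (hC l).le (mul_nonneg (auxW_nonneg B C hC _) (by positivity))
  · refine le_of_eq (auxW_step B C hC (φ m).1 m.1 l j hlj ?_ ?_).symm
    · simp [φ]
    · intro q hq
      simp [φ, hq]

/-- feasibility of the SFA rate allocation. For every route-level count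
vector `n` and every resource `l`, `Σ_{j : n_j ≥ 1} B_{lj} Φ(n - e_j) ≤ C_l Φ(n)`;
equivalently the SFA rates `φ_j(n) = Φ(n - e_j)/Φ(n)` satisfy the capacity constraints. -/
theorem sfa_rates_feasible
    {L J : Type*} [Fintype L] [Fintype J] [DecidableEq J] [Nonempty L] [Nonempty J]
    (B : L → J → ℝ) (C : L → ℝ)
    (hB : ∀ l j, 0 ≤ B l j) (hC : ∀ l, 0 < C l)
    (hroute : ∀ j : J, ∃ l : L, 0 < B l j)
    (n : J → ℕ) (l : L) :
    ∑ j ∈ Finset.univ.filter (fun j : J => 1 ≤ n j),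
        B l j * sfaPhiFun B C (Function.update n j (n j - 1)) ≤
      C l * sfaPhiFun B C n := by
  have := auxU_finite B n
  have := Fintype.ofFinite (sfaU B n)
  let r : J → sfaU B n → ℝ := fun j m => if h : 0 < B l j then auxW B C m.1 *
      ((m.1 ⟨(l, j), h⟩ : ℝ) /
        ((∑ j : {j : J // 0 < B l j}, m.1 ⟨(l, j.1), j.2⟩ : ℕ) : ℝ)) else 0
  have hr0 : ∀ j m, 0 ≤ r j m := by
    intro j m
    simp only [r]
    split_ifs
    · exact mul_nonneg (auxW_nonneg B C hC _) (by positivity)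
    · exact le_rfl
  have hr : ∀ m, ∑ j, r j m ≤ auxW B C m.1 := by
    intro m
    have e : ∑ j, r j m = ∑ j : {j : J // 0 < B l j}, auxW B C m.1 *
      ((m.1 ⟨(l, j.1), j.2⟩ : ℝ) /
        ((∑ j : {j : J // 0 < B l j}, m.1 ⟨(l, j.1), j.2⟩ : ℕ) : ℝ)) := by
      rw [← Fintype.sum_subtype_add_sum_subtype (fun j => 0 < B l j) (fun j => r j m)]
      have z : ∑ j : {j : J // ¬ 0 < B l j}, r j.1 m = 0 :=
        Finset.sum_eq_zero fun j _ => dif_neg j.2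
      rw [z, add_zero]
      exact Finset.sum_congr rfl fun j _ => dif_pos j.2
    rw [e, ← Finset.mul_sum, ← Finset.sum_div, ← Nat.cast_sum]
    exact mul_le_of_le_one_right (auxW_nonneg B C hC _) (div_self_le_one _)
  calc _ ≤ ∑ j ∈ Finset.univ.filter (fun j : J => 1 ≤ n j), C l * ∑ m, r j m := by
        refine Finset.sum_le_sum fun j hj => ?_
        have hj1 : 1 ≤ n j := by simpa using hj
        by_cases h : 0 < B l j
        · have := aux_route B C hC n (Function.update n j (n j - 1)) l j h
            (by simp; omega) (fun i hi => by simp [hi])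
          rw [tsum_fintype] at this
          simpa only [r, dif_pos h] using this
        · have h0 : B l j = 0 := le_antisymm (not_lt.mp h) (hB l j)
          rw [h0, zero_mul]
          exact mul_nonneg (hC l).le (Finset.sum_nonneg fun m _ => hr0 j m)
    _ ≤ ∑ j, C l * ∑ m, r j m :=
        Finset.sum_le_sum_of_subset_of_nonneg (Finset.filter_subset _ _) fun j _ _ =>
          mul_nonneg (hC l).le (Finset.sum_nonneg fun m _ => hr0 j m)
    _ = C l * ∑ m, ∑ j, r j m := by rw [← Finset.mul_sum, Finset.sum_comm]
    _ ≤ C l * ∑ m : sfaU B n, auxW B C m.1 :=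
        mul_le_mul_of_nonneg_left (Finset.sum_le_sum fun m _ => hr m) (hC l).le
    _ = C l * sfaPhiFun B C n := by
        unfold sfaPhiFun
        rw [tsum_fintype]
        rfl
end
end
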